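/- For any λ>0, any edge e(r,s) of G, and any two points y,y' on e(r,s) with t(y)<t(y'), one has Q_r(y')⊆Q_r(y); consequently f_r(e,x)=|Q_r(x)| is a nonincreasing piecewise-constant function of t(x) on e(r,s). -/

import Mathlib

namespace KCenter

/-- A connected undirected graph network: each vertex `v` has a positive weight `w v`
and each edge `{u,v}` has a positive length `len u v`. -/
structure Net (V : Type) [Fintype V] [DecidableEq V] where
  G : SimpleGraph V
  conn : G.Connected
  w : V → ℝ
  w_pos : ∀ v, 0 < w v
  len : V → V → ℝ
  len_symm : ∀ u v, len u v = len v u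
  len_pos : ∀ u v, G.Adj u v → 0 < len u v

variable {V : Type} [Fintype V] [DecidableEq V]

/-- The length of a walk: the sum of the lengths of its edges. -/
noncomputable def wlen (N : Net V) {u v : V} (p : N.G.Walk u v) : ℝ :=
  (p.edges.map (Sym2.lift ⟨N.len, N.len_symm⟩)).sum

/-- The shortest-path distance between two vertices. -/
noncomputable def dV (N : Net V) (u v : V) : ℝ :=
  sInf {r : ℝ | ∃ p : N.G.Walk u v, wlen N p = r}

/-- A point of the graph: it lies on the edge `e(u,v)` at distance `t` from `u`
(with `0 ≤ t ≤ len u v`). -/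
structure Pt (N : Net V) where
  u : V
  v : V
  adj : N.G.Adj u v
  t : ℝ
  ht0 : 0 ≤ t
  ht1 : t ≤ N.len u v

/-- The length of the edge a point lies on. -/
noncomputable def elen {N : Net V} (x : Pt N) : ℝ := N.len x.u x.v

/-- The shortest-path distance from a point to a vertex. -/
noncomputable def dP (N : Net V) (x : Pt N) (a : V) : ℝ :=
  min (x.t + dV N x.u a) ((elen x - x.t) + dV N x.v a)

/-- `par` encodes a shortest path tree of the point `x`, rooted at the (possibly dummy)
vertex containing `x`: `par a = none` means `a` is attached directly to `x` along the edge
containing `x`, and `par a = some b` means `b` is the tree parent of `a`; in both cases the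
tree path from `x` to `a` is a shortest path. -/
def IsSPT (N : Net V) (x : Pt N) (par : V → Option V) : Prop :=
  ∀ a : V,
    (par a = none →
      (a = x.u ∧ dP N x a = x.t) ∨ (a = x.v ∧ dP N x a = elen x - x.t)) ∧
    (∀ b : V, par a = some b → N.G.Adj b a ∧ dP N x b + N.len b a = dP N x a)

/-- Adjacency in the shortest path tree encoded by `par` (among real vertices). -/
def tAdj (par : V → Option V) (a b : V) : Prop := par a = some b ∨ par b = some a

/-- A set `S` of vertices is connected under the relation `r` using only vertices of `S`. -/
def ConnIn (r : V → V → Prop) (S : Set V) : Prop :=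
  ∀ a ∈ S, ∀ b ∈ S, Relation.ReflTransGen (fun p q => q ∈ S ∧ r p q) a b

/-- `S` is (the vertex set of) a `k`-subtree of a shortest path tree of `x`,
i.e. `S` has `k` vertices and is connected inside some shortest path tree of `x`. -/
def IsKSub (N : Net V) (k : ℕ) (x : Pt N) (S : Set V) : Prop :=
  S.ncard = k ∧ ∃ par : V → Option V, IsSPT N x par ∧ ConnIn (tAdj par) S

/-- `max_{v ∈ S} w v * d(x,v)`. -/
noncomputable def mval (N : Net V) (x : Pt N) (S : Set V) : ℝ :=
  sSup {y : ℝ | ∃ v ∈ S, y = N.w v * dP N x v}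

/-- The set of objective values `max_{v∈T^k} w_v d(x,v)` over all points `x` of `G` and all
`k`-subtrees `T^k` of shortest path trees of `x`; its least element is `λ* = min_x φ(x,G)`. -/
def vals (N : Net V) (k : ℕ) : Set ℝ :=
  {y : ℝ | ∃ (x : Pt N) (S : Set V), IsKSub N k x S ∧ y = mval N x S}

/-- The point `x` is a point of the subtree with vertex set `S`:
it is located at a vertex of `S`, or interior of an edge with both endpoints in `S`. -/
def PtOn (N : Net V) (x : Pt N) (S : Set V) : Prop :=
  (x.t = 0 ∧ x.u ∈ S) ∨ (x.t = elen x ∧ x.v ∈ S) ∨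
  (0 < x.t ∧ x.t < elen x ∧ x.u ∈ S ∧ x.v ∈ S)

/-- `a` is a neutral vertex of `x` (equivalently, `x` is the semicircular point of `a` on
the edge containing `x`). -/
def Neutral (N : Net V) (x : Pt N) (a : V) : Prop :=
  dV N a x.u + x.t = dV N a x.v + (elen x - x.t)

/-- `V_r(x)`: vertices strictly on the `x.u`-side of `x`. -/
def Vr (N : Net V) (x : Pt N) : Set V :=
  {a | dV N a x.u + x.t < dV N a x.v + (elen x - x.t)}

/-- `V_s(x)`: vertices strictly on the `x.v`-side of `x`. -/
def Vs (N : Net V) (x : Pt N) : Set V :=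
  {a | dV N a x.v + (elen x - x.t) < dV N a x.u + x.t}

/-- `V̄(x)`: the set of neutral vertices of `x`. -/
def NbarSet (N : Net V) (x : Pt N) : Set V := {a | Neutral N x a}

/-- `Λ`: the local one-center objective values; for an edge `e(r,s)` and two distinct
vertices `u ≠ v`, the value of an intersection of the increasing branch of `D(u,·)`
with the decreasing branch of `D(v,·)` at a point of `e(r,s)`. -/
def Lam1 (N : Net V) : Set ℝ :=
  {y : ℝ | ∃ r s : V, N.G.Adj r s ∧ ∃ u v : V, u ≠ v ∧ ∃ t : ℝ,
    0 ≤ t ∧ t ≤ N.len r s ∧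
    dV N u r + t ≤ dV N u s + (N.len r s - t) ∧
    dV N v s + (N.len r s - t) ≤ dV N v r + t ∧
    N.w u * (dV N u r + t) = y ∧ N.w v * (dV N v s + (N.len r s - t)) = y}

/-- `Λ'`: the values `w_v · d(v, x')` over all vertices `v` and all semicircular points `x'`
(of any vertex `u`) on edges of `G`. -/
def Lam2 (N : Net V) : Set ℝ :=
  {y : ℝ | ∃ v u r s : V, N.G.Adj r s ∧ ∃ t : ℝ,
    0 ≤ t ∧ t ≤ N.len r s ∧
    dV N u r + t = dV N u s + (N.len r s - t) ∧
    y = N.w v * min (t + dV N r v) ((N.len r s - t) + dV N s v)}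

/-- `S` is (the vertex set of) a `k`-subtree of `G`. -/
def KSubG (N : Net V) (k : ℕ) (S : Set V) : Prop :=
  S.ncard = k ∧ ConnIn N.G.Adj S

/-- The weighted diameter `W(G') = max_{u,v∈V(G')} w_u w_v d(u,v)/(w_u+w_v)`. -/
noncomputable def Wd (N : Net V) (S : Set V) : ℝ :=
  sSup {y : ℝ | ∃ u ∈ S, ∃ v ∈ S, y = N.w u * N.w v * dV N u v / (N.w u + N.w v)}

/-- The subtree with vertex set `S` is covered by the point `x` under `lam`. -/
def Covered (N : Net V) (lam : ℝ) (x : Pt N) (S : Set V) : Prop :=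
  ∀ v ∈ S, N.w v * dP N x v ≤ lam

/-- The vertex `a` is the (real) vertex at which the point `x` is located. -/
def AtX (N : Net V) (x : Pt N) (a : V) : Prop :=
  (x.t = 0 ∧ a = x.u) ∨ (x.t = elen x ∧ a = x.v)

/-- `S` together with `x` induces a connected subtree of the shortest path tree `par` of `x`:
`S` is closed under tree parents, up to the root `x`. -/
def SelfIncl (N : Net V) (x : Pt N) (par : V → Option V) (S : Set V) : Prop :=
  ∀ a ∈ S, ∀ b : V, par a = some b → b ∈ S ∨ AtX N x b

/-- `S` is a covered self-inclusive subtree of `x` under `lam`. -/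
def CSI (N : Net V) (lam : ℝ) (x : Pt N) (S : Set V) : Prop :=
  ∃ par : V → Option V, IsSPT N x par ∧ SelfIncl N x par S ∧ Covered N lam x S

/-- `a` is a heavy vertex of `x`: it cannot be covered by `x` under `lam`. -/
def Heavy (N : Net V) (lam : ℝ) (x : Pt N) (a : V) : Prop := lam < N.w a * dP N x a

/-- The walk `p` (from `a` to an endpoint of the edge containing `x`), extended by the
corresponding segment to `x`, is a shortest path from `a` to `x`. -/
def ShortestToX (N : Net V) (x : Pt N) {a b : V} (p : N.G.Walk a b) : Prop :=
  (b = x.u ∧ wlen N p + x.t = dP N x a) ∨ (b = x.v ∧ wlen N p + (elen x - x.t) = dP N x a)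

/-- `a` is a descendant of the set `S` w.r.t. `x`: every shortest path from `a` to `x`
contains a vertex of `S`. -/
def DescOf (N : Net V) (x : Pt N) (S : Set V) (a : V) : Prop :=
  ∀ (b : V) (p : N.G.Walk a b), ShortestToX N x p → ∃ c ∈ p.support, c ∈ S

/-- `a` is a light vertex of `x`: it is neither heavy nor a descendant of the set of heavy
vertices of `x`. -/
def Light (N : Net V) (lam : ℝ) (x : Pt N) (a : V) : Prop :=
  ¬ Heavy N lam x a ∧ ¬ DescOf N x {c | Heavy N lam x c} a

/-- `f(e,x) = |V(T_λ(x))|`: the maximum cardinality of a covered self-inclusive subtree of `x`. -/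
noncomputable def fval (N : Net V) (lam : ℝ) (x : Pt N) : ℕ :=
  sSup {c : ℕ | ∃ S : Set V, CSI N lam x S ∧ S.ncard = c}

/-- `a` is light by `r = x.u` w.r.t. `x`: it has a shortest path to `x` through the segment
between `r` and `x` that contains no heavy vertex of `x`. -/
def LightByR (N : Net V) (lam : ℝ) (x : Pt N) (a : V) : Prop :=
  ∃ p : N.G.Walk a x.u, wlen N p + x.t = dP N x a ∧ ∀ c ∈ p.support, ¬ Heavy N lam x c

/-- `a` is light by `s = x.v` w.r.t. `x`. -/
def LightByS (N : Net V) (lam : ℝ) (x : Pt N) (a : V) : Prop :=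
  ∃ p : N.G.Walk a x.v, wlen N p + (elen x - x.t) = dP N x a ∧ ∀ c ∈ p.support, ¬ Heavy N lam x c

/-- `Q_r(x)`: the light-by-`r` vertices of `x` in `V_r(x)` together with the neutral vertices
of `x` that are light by `r`. -/
def Qr (N : Net V) (lam : ℝ) (x : Pt N) : Set V :=
  {a | dV N a x.u + x.t ≤ dV N a x.v + (elen x - x.t) ∧ LightByR N lam x a}

/-- `Q_s(x)`: the light-by-`s` vertices of `x` in `V_s(x)` together with the neutral vertices
of `x` that are light by `s`. -/
def Qs (N : Net V) (lam : ℝ) (x : Pt N) : Set V :=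
  {a | dV N a x.v + (elen x - x.t) ≤ dV N a x.u + x.t ∧ LightByS N lam x a}

/-- In a tree, the point `x` lies on the path from the vertex `v` to the vertex `root`. -/
def OnPathToRoot (N : Net V) (root v : V) (x : Pt N) : Prop :=
  dP N x v + dP N x root = dV N v root

/-- `x` is the critical point of the vertex `v` w.r.t. `root`: it lies on the path from `v`
to `root`; it satisfies `w_v · d(v,x) = λ` when this equation has a solution on the path
(i.e. when `λ ≤ w_v · d(v,root)`), and it is the root otherwise. -/
def CritPt (N : Net V) (lam : ℝ) (root v : V) (x : Pt N) : Prop :=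
  OnPathToRoot N root v x ∧
    ((lam ≤ N.w v * dV N v root ∧ N.w v * dP N x v = lam) ∨
     (N.w v * dV N v root < lam ∧ dP N x root = 0))

section WalkLength

variable (N : Net V)

lemma wlen_nonneg {u v : V} (p : N.G.Walk u v) : 0 ≤ wlen N p := by
  refine List.sum_nonneg fun y hy => ?_
  obtain ⟨e, he, rfl⟩ := List.mem_map.1 hy
  induction e with
  | _ a b => exact (N.len_pos a b (p.adj_of_mem_edges he)).le

lemma wlen_append {u v z : V} (p : N.G.Walk u v) (q : N.G.Walk v z) :
    wlen N (p.append q) = wlen N p + wlen N q := by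
  simp [wlen]

lemma wlen_reverse {u v : V} (p : N.G.Walk u v) : wlen N p.reverse = wlen N p := by
  simp [wlen, List.sum_reverse]

lemma dV_le_wlen {u v : V} (p : N.G.Walk u v) : dV N u v ≤ wlen N p :=
  csInf_le ⟨0, by rintro _ ⟨q, rfl⟩; exact wlen_nonneg N q⟩ ⟨p, rfl⟩

lemma le_dV {u v : V} {c : ℝ} (hc : ∀ p : N.G.Walk u v, c ≤ wlen N p) : c ≤ dV N u v := by
  obtain ⟨p⟩ := N.conn.preconnected u v
  refine le_csInf ⟨_, p, rfl⟩ ?_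
  rintro _ ⟨q, rfl⟩
  exact hc q

lemma dV_comm (u v : V) : dV N u v = dV N v u :=
  le_antisymm
    (le_dV N fun p => (dV_le_wlen N p.reverse).trans_eq (wlen_reverse N p))
    (le_dV N fun p => (dV_le_wlen N p.reverse).trans_eq (wlen_reverse N p))

lemma dV_le_dV_add_wlen {u v z : V} (q : N.G.Walk v z) : dV N u z ≤ dV N u v + wlen N q := by
  rw [← sub_le_iff_le_add]
  refine le_dV N fun p => ?_
  rw [sub_le_iff_le_add, ← wlen_append]
  exact dV_le_wlen N _

end WalkLength

/-- Moving a point towards `r` along the edge `e(r,s)` can only enlarge `Q_r`. -/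
lemma Qr_antitone (N : Net V) (lam : ℝ) {r s : V} (h : N.G.Adj r s) {t t' : ℝ}
    (ht0 : 0 ≤ t) (htt : t ≤ t') (ht1 : t' ≤ N.len r s) :
    Qr N lam ⟨r, s, h, t', ht0.trans htt, ht1⟩ ⊆ Qr N lam ⟨r, s, h, t, ht0, htt.trans ht1⟩ := by
  rintro a ⟨hside, p, hp, hlight⟩
  change N.G.Walk a r at p
  simp only [Heavy, dP, elen, not_lt] at hside hp hlight
  rw [dV_comm N a r, dV_comm N a s] at hside
  rw [min_eq_left (by linarith)] at hp
  refine ⟨?_, p, ?_, fun c hc => ?_⟩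
  · simp only [elen]
    rw [dV_comm N a r, dV_comm N a s]
    linarith
  · simp only [dP, elen]
    rw [min_eq_left (by linarith)]
    linarith
  · have hsplit : wlen N (p.takeUntil c hc) + wlen N (p.dropUntil c hc) = wlen N p := by
      rw [← wlen_append, SimpleGraph.Walk.take_spec]
    have hr : dV N r c ≤ wlen N (p.dropUntil c hc) :=
      (dV_comm N r c).trans_le (dV_le_wlen N _)
    have hs : dV N s a ≤ dV N s c + wlen N (p.takeUntil c hc) :=
      (dV_le_dV_add_wlen N (p.takeUntil c hc).reverse).trans_eq (by rw [wlen_reverse])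
    have hc' := hlight c hc
    rw [min_eq_left (by linarith)] at hc'
    simp only [Heavy, dP, elen, not_lt]
    refine (mul_le_mul_of_nonneg_left ?_ (N.w_pos c).le).trans hc'
    exact (min_le_left _ _).trans (by linarith)

/-- A bounded `ℕ`-valued function that is nonincreasing on a set of reals is constant on the
closed intervals avoiding some finite set of breakpoints. -/
lemma exists_finset_breakpoints {D : Set ℝ} {f : ℝ → ℕ} (hf : AntitoneOn f D) {n : ℕ}
    (hn : ∀ t ∈ D, f t ≤ n) :
    ∃ B : Finset ℝ, ∀ t ∈ D, ∀ t' ∈ D, t ≤ t' → (∀ b ∈ B, ¬ (t ≤ b ∧ b ≤ t')) → f t = f t' := by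
  refine ⟨(Finset.range (n + 1)).image fun k => sSup {u | u ∈ D ∧ k ≤ f u},
    fun t ht t' ht' htt hB => ?_⟩
  by_contra hne
  have hlt : f t' < f t := lt_of_le_of_ne (hf ht ht' htt) (Ne.symm hne)
  have hub : ∀ u ∈ {u | u ∈ D ∧ f t ≤ f u}, u ≤ t' := by
    rintro u ⟨hu, hfu⟩
    by_contra! hlt'
    exact absurd (hf ht' hu hlt'.le) (by omega)
  have hmem : t ∈ {u | u ∈ D ∧ f t ≤ f u} := ⟨ht, le_rfl⟩
  exact hB _ (Finset.mem_image_of_mem _ (Finset.mem_range_succ_iff.2 (hn t ht)))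
    ⟨le_csSup ⟨t', hub⟩ hmem, csSup_le ⟨t, hmem⟩ hub⟩

/-- For any `λ > 0`, any edge `e(r,s)` of `G`, and any two points
`y, y'` on `e(r,s)` with `t(y) < t(y')`, one has `Q_r(y') ⊆ Q_r(y)`; consequently
`f_r(e,x) = |Q_r(x)|` is a nonincreasing piecewise-constant function of `t(x)` on
`e(r,s)`. -/
theorem stmt13 {V : Type} [Fintype V] [DecidableEq V] (N : Net V)
    (lam : ℝ) (hlam : 0 < lam) (r s : V) (h : N.G.Adj r s) :
    (∀ (t t' : ℝ) (ht0 : 0 ≤ t) (htt : t < t') (ht1 : t' ≤ N.len r s),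
      Qr N lam ⟨r, s, h, t', ht0.trans htt.le, ht1⟩ ⊆
        Qr N lam ⟨r, s, h, t, ht0, htt.le.trans ht1⟩) ∧
    (∀ (t t' : ℝ) (ht0 : 0 ≤ t) (htt : t ≤ t') (ht1 : t' ≤ N.len r s),
      (Qr N lam ⟨r, s, h, t', ht0.trans htt, ht1⟩).ncard ≤
        (Qr N lam ⟨r, s, h, t, ht0, htt.trans ht1⟩).ncard) ∧
    (∃ B : Finset ℝ, ∀ (t t' : ℝ) (ht0 : 0 ≤ t) (htt : t ≤ t') (ht1 : t' ≤ N.len r s),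
      (∀ b ∈ B, ¬ (t ≤ b ∧ b ≤ t')) →
      (Qr N lam ⟨r, s, h, t, ht0, htt.trans ht1⟩).ncard =
        (Qr N lam ⟨r, s, h, t', ht0.trans htt, ht1⟩).ncard) := by
  classical
  have hcard : ∀ (t t' : ℝ) (ht0 : 0 ≤ t) (htt : t ≤ t') (ht1 : t' ≤ N.len r s),
      (Qr N lam ⟨r, s, h, t', ht0.trans htt, ht1⟩).ncard ≤
        (Qr N lam ⟨r, s, h, t, ht0, htt.trans ht1⟩).ncard := fun t t' ht0 htt ht1 =>
    Set.ncard_le_ncard (Qr_antitone N lam h ht0 htt ht1) (Set.toFinite _)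
  refine ⟨fun t t' ht0 htt ht1 => Qr_antitone N lam h ht0 htt.le ht1, hcard, ?_⟩
  let f : ℝ → ℕ := fun t =>
    if ht : 0 ≤ t ∧ t ≤ N.len r s then (Qr N lam ⟨r, s, h, t, ht.1, ht.2⟩).ncard else 0
  have hfeq (t : ℝ) (h0 : 0 ≤ t) (h1 : t ≤ N.len r s) :
      f t = (Qr N lam ⟨r, s, h, t, h0, h1⟩).ncard := dif_pos ⟨h0, h1⟩
  have hf : AntitoneOn f (Set.Icc 0 (N.len r s)) := fun t ht t' ht' htt => by
    rw [hfeq t ht.1 ht.2, hfeq t' ht'.1 ht'.2]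
    exact hcard t t' ht.1 htt ht'.2
  have hn : ∀ t ∈ Set.Icc 0 (N.len r s), f t ≤ Nat.card V := fun t ht => by
    rw [hfeq t ht.1 ht.2]
    exact Set.ncard_le_card _
  obtain ⟨B, hB⟩ := exists_finset_breakpoints hf hn
  refine ⟨B, fun t t' ht0 htt ht1 hb => ?_⟩
  rw [← hfeq, ← hfeq]
  exact hB t ⟨ht0, htt.trans ht1⟩ t' ⟨ht0.trans htt, ht1⟩ htt hb

end KCenter
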